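/- Let n = 2r be an even integer with n ≥ 4, let F be a field with char F = 0 or char F > r, let C be a commutative F-algebra, and let Y ∈ V(C). Let k = 2m with 1 ≤ t ≤ m ≤ r, and let P', Q' ⊆ {1,…,r} with |P'| + |Q'| = k − 2t. Then ∑_{Γ_t} [P' ∪ Γ_t, overline(Q' ∪ Γ_t)] = 0 in C, where Γ_t ranges over all subsets of {1,…,r} ∖ (P' ∪ Q') of size t. -/

import Mathlib

open scoped Matrix

noncomputable section

namespace PR

/-- The polynomial ring `R[Y_{ij} : 1 ≤ i, j ≤ n]`, `n = 2r`. -/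
abbrev PolyRing (r : ℕ) (R : Type*) [CommRing R] :=
  MvPolynomial (Fin (2 * r) × Fin (2 * r)) R

/-- The standard symplectic form matrix `J` (`n = 2r`). -/
def Jmat (r : ℕ) (R : Type*) [CommRing R] : Matrix (Fin (2 * r)) (Fin (2 * r)) R :=
  Matrix.of fun i j =>
    if (j : ℕ) = (i : ℕ) + r then 1 else if (i : ℕ) = (j : ℕ) + r then -1 else 0

/-- The generic `n × n` matrix of indeterminates. -/
def Ygen (r : ℕ) (R : Type*) [CommRing R] :
    Matrix (Fin (2 * r)) (Fin (2 * r)) (MvPolynomial (Fin (2 * r) × Fin (2 * r)) R) :=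
  Matrix.of fun i j => MvPolynomial.X (i, j)

/-- The defining ideal of the scheme `V`. -/
def VIdeal (r : ℕ) (R : Type*) [CommRing R] :
    Ideal (MvPolynomial (Fin (2 * r) × Fin (2 * r)) R) :=
  Ideal.span
    ({p | ∃ i j, p = (Ygen r R + (Ygen r R)ᵀ) i j} ∪
     {p | ∃ i, p = Ygen r R i i} ∪
     {p | ∃ i j, p = ((Ygen r R)ᵀ * Jmat r (PolyRing r R) * Ygen r R) i j} ∪
     {p | ∃ k, p = (Matrix.charpoly (-(Jmat r (PolyRing r R) * Ygen r R)) - Polynomial.X ^ (2 * r)).coeff k})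

/-- The coordinate ring `R[V]`. -/
abbrev FV (r : ℕ) (R : Type*) [CommRing R] :=
  MvPolynomial (Fin (2 * r) × Fin (2 * r)) R ⧸ VIdeal r R

/-- The pfaffian of an `m × m` matrix (nonzero only for even `m`), defined as a signed sum over
permutations `σ` with `σ(2i-1) < σ(2i)` for each pair and `σ(1) < σ(3) < ⋯` (here 0-indexed). -/
def pf {m : ℕ} {R : Type*} [CommRing R] (A : Matrix (Fin m) (Fin m) R) : R :=
  ∑ σ ∈ Finset.univ.filter (fun σ : Equiv.Perm (Fin m) =>
      (∀ i : Fin (m / 2),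
        σ ⟨2 * i.val, by have := i.isLt; omega⟩ < σ ⟨2 * i.val + 1, by have := i.isLt; omega⟩) ∧
      ∀ i j : Fin (m / 2), i < j →
        σ ⟨2 * i.val, by have := i.isLt; omega⟩ < σ ⟨2 * j.val, by have := j.isLt; omega⟩),
    (Equiv.Perm.sign σ : ℤ) •
      ∏ i : Fin (m / 2),
        A (σ ⟨2 * i.val, by have := i.isLt; omega⟩) (σ ⟨2 * i.val + 1, by have := i.isLt; omega⟩)

/-- `[i₁, …, i₂ₗ]`: the pfaffian of the submatrix of `Y` given by a list of indices. -/
def listPf {n : ℕ} {R : Type*} [CommRing R] (Y : Matrix (Fin n) (Fin n) R)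
    (L : List (Fin n)) : R :=
  pf (Matrix.of fun a b : Fin L.length => Y (L.get a) (L.get b))

/-- The product of pfaffians associated to a tableau (rows as lists of entries),
as a polynomial. -/
def tabPoly (r : ℕ) (R : Type*) [CommRing R] (T : List (List (Fin (2 * r)))) :
    MvPolynomial (Fin (2 * r) × Fin (2 * r)) R :=
  (T.map (listPf (Ygen r R))).prod

/-- `[T]`, the class of the product of pfaffians of the rows of `T` in `R[V]`. -/
def tabElem (r : ℕ) (R : Type*) [CommRing R] (T : List (List (Fin (2 * r)))) : FV r R :=
  Ideal.Quotient.mk (VIdeal r R) (tabPoly r R T)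

/-- Position of an index in the order `1̄ ≺ 1 ≺ 2̄ ≺ 2 ≺ ⋯ ≺ r̄ ≺ r`, where `ī := r + i`
(0-indexed: `ī` is `r + i - 1` and `i` is `i - 1`). -/
def ordIdx (r : ℕ) (x : Fin (2 * r)) : ℕ :=
  if x.val < r then 2 * x.val + 1 else 2 * (x.val - r)

/-- A list of rows represents a tableau of shape a partition: row lengths weakly decreasing
and positive. -/
def IsShape {α : Type*} (T : List (List α)) : Prop :=
  (T.map List.length).Chain' (fun a b => b ≤ a) ∧ ∀ row ∈ T, row ≠ []

/-- An even-tableau: every row has even length. -/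
def IsEvenTab {α : Type*} (T : List (List α)) : Prop :=
  ∀ row ∈ T, Even row.length

/-- Standard: entries strictly increase along each row and weakly increase down each column,
with respect to the order `≺`. -/
def IsStandard (r : ℕ) (T : List (List (Fin (2 * r)))) : Prop :=
  (∀ row ∈ T, row.Chain' (fun a b => ordIdx r a < ordIdx r b)) ∧
  ∀ (i t : ℕ) (hi : i + 1 < T.length) (ht' : t < (T[i]'(Nat.lt_of_succ_lt hi)).length)
    (ht : t < (T[i + 1]'hi).length),
    ordIdx r ((T[i]'(Nat.lt_of_succ_lt hi))[t]'ht') ≤ ordIdx r ((T[i + 1]'hi)[t]'ht)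

/-- The symplectic condition: the entries `p` and `p̄` (0-indexed: values `p` and `r + p`
for `p < r`) occur only in the first `p + 1` columns (0-indexed: columns `t ≤ p`). -/
def IsSymplectic (r : ℕ) (T : List (List (Fin (2 * r)))) : Prop :=
  ∀ (i t : ℕ) (hi : i < T.length) (ht : t < (T[i]'hi).length) (p : ℕ), p < r →
    (((T[i]'hi)[t]'ht).val = p ∨ ((T[i]'hi)[t]'ht).val = r + p) → t ≤ p

/-- A symplectic standard even-tableau. -/
def IsSSET (r : ℕ) (T : List (List (Fin (2 * r)))) : Prop :=
  IsShape T ∧ IsEvenTab T ∧ IsStandard r T ∧ IsSymplectic r T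

/-- A canonical tableau: in column `j` only `j̄` appears (0-indexed: column `t` contains
only the value `r + t`). -/
def IsCanonical (r : ℕ) (T : List (List (Fin (2 * r)))) : Prop :=
  ∀ (i t : ℕ) (hi : i < T.length) (ht : t < (T[i]'hi).length), ((T[i]'hi)[t]'ht).val = r + t

/-- The set `V(C)` of matrices. -/
def MemV (r : ℕ) {C : Type*} [CommRing C] (Y : Matrix (Fin (2 * r)) (Fin (2 * r)) C) : Prop :=
  Y = -Yᵀ ∧ (∀ i, Y i i = 0) ∧ Yᵀ * Jmat r C * Y = 0 ∧
    Matrix.charpoly (-(Jmat r C * Y)) = Polynomial.X ^ (2 * r)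

/-- The embedding `i ↦ i` of `{1, …, r}` into `{1, …, n}`. -/
def emb (r : ℕ) (i : Fin r) : Fin (2 * r) := ⟨i.val, by have := i.isLt; omega⟩

/-- The embedding `i ↦ ī = r + i` of `{1, …, r}` into `{1, …, n}`. -/
def embBar (r : ℕ) (i : Fin r) : Fin (2 * r) := ⟨r + i.val, by have := i.isLt; omega⟩

/-- The index list of `[P, Q̄]`: with `Γ₀ = P ∩ Q = {γ₁ < ⋯ < γ_λ}`, the list
`γ₁, γ̄₁, …, γ_λ, γ̄_λ` followed by `P ∖ Γ₀` in increasing order and then the bars of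
`Q ∖ Γ₀` in increasing order. -/
def pqList (r : ℕ) (P Q : Finset (Fin r)) : List (Fin (2 * r)) :=
  ((P ∩ Q).sort (· ≤ ·)).flatMap (fun γ => [emb r γ, embBar r γ]) ++
    ((P \ Q).sort (· ≤ ·)).map (emb r) ++ ((Q \ P).sort (· ≤ ·)).map (embBar r)

/-- The pfaffian `[P, Q̄]` of the matrix `Y`. -/
def pfPQ (r : ℕ) {C : Type*} [CommRing C] (Y : Matrix (Fin (2 * r)) (Fin (2 * r)) C)
    (P Q : Finset (Fin r)) : C :=
  listPf Y (pqList r P Q)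

/-- The defining ideal of the scheme `W`. -/
def WIdeal (r : ℕ) (R : Type*) [CommRing R] : Ideal (PolyRing r R) :=
  Ideal.span
    ({p | ∃ i j, p = (Jmat r (PolyRing r R) * (Ygen r R)ᵀ * Jmat r (PolyRing r R)
            + Ygen r R) i j} ∪
     {p | ∃ i j, p = (Ygen r R * Ygen r R) i j} ∪
     {p | ∃ k, p = (Matrix.charpoly (Ygen r R) - Polynomial.X ^ (2 * r)).coeff k})

/-- The coordinate ring `R[W]`. -/
abbrev FW (r : ℕ) (R : Type*) [CommRing R] := PolyRing r R ⧸ WIdeal r R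


open CliffordAlgebra in
/-- An alternating bilinear form `β` induces a linear functional on the exterior algebra
satisfying the expansion rule of pfaffians (Wick's theorem). -/
theorem exists_functional_contractLeft {R M : Type*} [CommRing R] [AddCommGroup M] [Module R M]
    (β : LinearMap.BilinForm R M) (hβ : ∀ v, β v v = 0) :
    ∃ φ : ExteriorAlgebra R M →ₗ[R] R, φ 1 = 1 ∧
      ∀ v x, φ (ExteriorAlgebra.ι R v * x) = φ (contractLeft (Q := 0) (β v) x) := by
  have h : (-β).toQuadraticMap = (0 : QuadraticForm R M) - 0 := by
    ext v
    simp [hβ]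
  refine ⟨ExteriorAlgebra.algebraMapInv.toLinearMap ∘ₗ changeForm h, by simp, fun v x => ?_⟩
  have h1 : changeForm h (ExteriorAlgebra.ι R v * x) = _ := changeForm_ι_mul h v x
  rw [LinearMap.comp_apply, LinearMap.comp_apply, h1, changeForm_contractLeft]
  have h2 : ExteriorAlgebra.algebraMapInv (R := R) (ι (0 : QuadraticForm R M) v) = 0 := by
    change ExteriorAlgebra.algebraMapInv (ExteriorAlgebra.ι R v) = 0
    simp [ExteriorAlgebra.algebraMapInv]
  simp [h2]

theorem contractLeft_ιMulti {R M : Type*} [CommRing R] [AddCommGroup M] [Module R M]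
    (d : Module.Dual R M) {n : ℕ} (v : Fin (n + 1) → M) :
    CliffordAlgebra.contractLeft (Q := 0) d (ExteriorAlgebra.ιMulti R (n + 1) v) =
      ∑ k : Fin (n + 1), ((-1) ^ (k : ℕ) * d (v k)) •
        ExteriorAlgebra.ιMulti R n (v ∘ k.succAbove) := by
  induction n with
  | zero =>
    rw [ExteriorAlgebra.ιMulti_succ_apply]
    have := CliffordAlgebra.contractLeft_ι_mul (Q := (0 : QuadraticForm R M)) d (v 0)
      (ExteriorAlgebra.ιMulti R 0 (Matrix.vecTail v))
    refine this.trans ?_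
    simp [CliffordAlgebra.contractLeft_one]
  | succ n ih =>
    rw [ExteriorAlgebra.ιMulti_succ_apply]
    have := CliffordAlgebra.contractLeft_ι_mul (Q := (0 : QuadraticForm R M)) d (v 0)
      (ExteriorAlgebra.ιMulti R (n + 1) (Matrix.vecTail v))
    refine this.trans ?_
    rw [ih, sub_eq_add_neg, Finset.mul_sum, ← Finset.sum_neg_distrib,
      Fin.sum_univ_succ (n := n + 1)]
    congr 1
    · simp [Matrix.vecTail, Function.comp_def]
    · refine Finset.sum_congr rfl fun k _ => ?_
      rw [ExteriorAlgebra.ιMulti_succ_apply]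
      have h0 : (v ∘ k.succ.succAbove) 0 = v 0 := by simp
      have h1 : Matrix.vecTail (v ∘ k.succ.succAbove) = Matrix.vecTail v ∘ k.succAbove := by
        ext i
        simp [Matrix.vecTail]
      rw [h0, h1, mul_smul_comm, ← neg_smul]
      simp [Matrix.vecTail, pow_succ]

/-- The permutation of `Fin (n + 2)` fixing `0`, sending `1` to `k.succ`, and sending the remaining
indices to the remaining values in the order prescribed by `τ`. -/
def pairExtend {n : ℕ} (k : Fin (n + 1)) (τ : Equiv.Perm (Fin n)) : Equiv.Perm (Fin (n + 2)) :=
  Equiv.Perm.decomposeFin.symm (0, k.cycleRange⁻¹ * Equiv.Perm.decomposeFin.symm (0, τ))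

theorem pairExtend_zero {n : ℕ} (k : Fin (n + 1)) (τ : Equiv.Perm (Fin n)) :
    pairExtend k τ 0 = 0 := by
  simp [pairExtend]

theorem pairExtend_one {n : ℕ} (k : Fin (n + 1)) (τ : Equiv.Perm (Fin n)) :
    pairExtend k τ 1 = k.succ := by
  simp [pairExtend, Equiv.Perm.inv_def]

theorem pairExtend_succ_succ {n : ℕ} (k : Fin (n + 1)) (τ : Equiv.Perm (Fin n)) (i : Fin n) :
    pairExtend k τ i.succ.succ = (k.succAbove (τ i)).succ := by
  simp [pairExtend, Equiv.Perm.inv_def]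

theorem sign_pairExtend {n : ℕ} (k : Fin (n + 1)) (τ : Equiv.Perm (Fin n)) :
    Equiv.Perm.sign (pairExtend k τ) = (-1) ^ (k : ℕ) * Equiv.Perm.sign τ := by
  simp [pairExtend]

theorem exists_pairExtend {n : ℕ} (σ : Equiv.Perm (Fin (n + 2))) (hσ : σ 0 = 0) :
    ∃ k τ, pairExtend k τ = σ := by
  obtain ⟨⟨p, ρ⟩, rfl⟩ := Equiv.Perm.decomposeFin.symm.surjective σ
  obtain rfl : p = 0 := by simpa using hσ
  obtain ⟨⟨q, τ⟩, hτ⟩ := Equiv.Perm.decomposeFin.symm.surjective ((ρ 0).cycleRange * ρ)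
  obtain rfl : q = 0 := by
    have := congrArg (fun e => e 0) hτ
    simpa using this
  exact ⟨ρ 0, τ, by rw [pairExtend, hτ, inv_mul_cancel_left]⟩

theorem pairExtend_injective {n : ℕ} {k k' : Fin (n + 1)} {τ τ' : Equiv.Perm (Fin n)}
    (h : pairExtend k τ = pairExtend k' τ') : k = k' ∧ τ = τ' := by
  obtain rfl : k = k' := by
    have := congrArg (fun e => e 1) h
    simpa [pairExtend_one] using this
  refine ⟨rfl, Equiv.ext fun i => ?_⟩
  have := congrArg (fun e => e i.succ.succ) h
  simpa [pairExtend_succ_succ] using this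

/-- The index `2 * i` of `Fin m`. -/
def evenIdx {l m : ℕ} (h : 2 * l ≤ m) (i : Fin l) : Fin m := ⟨2 * i, by omega⟩

/-- The index `2 * i + 1` of `Fin m`. -/
def oddIdx {l m : ℕ} (h : 2 * l ≤ m) (i : Fin l) : Fin m := ⟨2 * i + 1, by omega⟩

theorem evenIdx_zero {l m : ℕ} (h : 2 * (l + 1) ≤ m + 2) : evenIdx h 0 = 0 := rfl

theorem oddIdx_zero {l m : ℕ} (h : 2 * (l + 1) ≤ m + 2) : oddIdx h 0 = 1 := rfl

theorem evenIdx_succ {l m : ℕ} (h : 2 * (l + 1) ≤ m + 2) (h' : 2 * l ≤ m) (i : Fin l) :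
    evenIdx h i.succ = (evenIdx h' i).succ.succ := rfl

theorem oddIdx_succ {l m : ℕ} (h : 2 * (l + 1) ≤ m + 2) (h' : 2 * l ≤ m) (i : Fin l) :
    oddIdx h i.succ = (oddIdx h' i).succ.succ := rfl

/-- The condition on permutations in the definition of the pfaffian, for `l` pairs of indices. -/
def IsPfPerm {l m : ℕ} (h : 2 * l ≤ m) (σ : Equiv.Perm (Fin m)) : Prop :=
  (∀ i : Fin l, σ (evenIdx h i) < σ (oddIdx h i)) ∧
    ∀ i j : Fin l, i < j → σ (evenIdx h i) < σ (evenIdx h j)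

open scoped Classical in
theorem pf_eq_sum_isPfPerm {l m : ℕ} (h : 2 * l ≤ m) (hl : l = m / 2) {R : Type*} [CommRing R]
    (A : Matrix (Fin m) (Fin m) R) :
    pf A = ∑ σ ∈ Finset.univ.filter (fun σ : Equiv.Perm (Fin m) => IsPfPerm h σ),
      (Equiv.Perm.sign σ : ℤ) • ∏ i : Fin l, A (σ (evenIdx h i)) (σ (oddIdx h i)) := by
  subst hl
  rw [pf]
  refine Finset.sum_congr ?_ fun _ _ => rfl
  ext
  rw [Finset.mem_filter, Finset.mem_filter]
  rfl

theorem IsPfPerm.apply_zero {l : ℕ} {h : 2 * (l + 1) ≤ 2 * l + 2}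
    {σ : Equiv.Perm (Fin (2 * l + 2))} (hσ : IsPfPerm h σ) : σ 0 = 0 := by
  obtain ⟨j, hj⟩ := σ.surjective 0
  have hle : ∀ i : Fin (l + 1), σ 0 ≤ σ (evenIdx h i) := fun i => by
    cases i using Fin.cases with
    | zero => exact le_rfl
    | succ i => exact (hσ.2 0 i.succ (Fin.succ_pos i)).le
  rcases Nat.even_or_odd' j.val with ⟨c, hc | hc⟩
  · have h1 := hle ⟨c, by omega⟩
    rw [show evenIdx h ⟨c, by omega⟩ = j from Fin.ext hc.symm, hj] at h1
    exact Fin.le_zero_iff.mp h1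
  · have h1 := hσ.1 ⟨c, by omega⟩
    rw [show oddIdx h ⟨c, by omega⟩ = j from Fin.ext hc.symm, hj] at h1
    exact absurd h1 (Fin.not_lt_zero _)

theorem isPfPerm_pairExtend {l m : ℕ} (h : 2 * (l + 1) ≤ m + 2) (h' : 2 * l ≤ m)
    (k : Fin (m + 1)) (τ : Equiv.Perm (Fin m)) :
    IsPfPerm h (pairExtend k τ) ↔ IsPfPerm h' τ := by
  unfold IsPfPerm
  constructor
  · rintro ⟨h1, h2⟩
    refine ⟨fun i => ?_, fun i j hij => ?_⟩
    · simpa [evenIdx_succ h h', oddIdx_succ h h', pairExtend_succ_succ] using h1 i.succ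
    · simpa [evenIdx_succ h h', pairExtend_succ_succ, hij] using h2 i.succ j.succ
  · rintro ⟨h1, h2⟩
    refine ⟨fun i => ?_, fun i j hij => ?_⟩
    · cases i using Fin.cases with
      | zero =>
        rw [evenIdx_zero, oddIdx_zero, pairExtend_zero, pairExtend_one]
        exact Fin.succ_pos k
      | succ i => simpa [evenIdx_succ h h', oddIdx_succ h h', pairExtend_succ_succ] using h1 i
    · cases j using Fin.cases with
      | zero => exact absurd hij (Fin.not_lt_zero _)
      | succ j =>
        cases i using Fin.cases with
        | zero =>
          rw [evenIdx_zero, evenIdx_succ h h', pairExtend_zero, pairExtend_succ_succ]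
          exact Fin.succ_pos _
        | succ i =>
          simpa [evenIdx_succ h h', pairExtend_succ_succ] using h2 i j (by simpa using hij)

/-- Expansion of a pfaffian along the first row. -/
theorem pf_succ {l : ℕ} {R : Type*} [CommRing R]
    (A : Matrix (Fin (2 * l + 2)) (Fin (2 * l + 2)) R) :
    pf A = ∑ k : Fin (2 * l + 1), ((-1) ^ (k : ℕ) * A 0 k.succ) *
      pf (A.submatrix (fun i => (k.succAbove i).succ) (fun i => (k.succAbove i).succ)) := by
  classical
  have h : 2 * (l + 1) ≤ 2 * l + 2 := le_rfl
  have h' : 2 * l ≤ 2 * l := le_rfl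
  rw [pf_eq_sum_isPfPerm h (by omega)]
  simp_rw [pf_eq_sum_isPfPerm h' (by omega), Finset.mul_sum]
  rw [Finset.sum_sigma', eq_comm]
  refine Finset.sum_bij (fun p _ => pairExtend p.1 p.2) ?_ ?_ ?_ ?_
  · rintro ⟨k, τ⟩ hτ
    simpa [isPfPerm_pairExtend h h'] using hτ
  · rintro ⟨k, τ⟩ _ ⟨k', τ'⟩ _ he
    obtain ⟨rfl, rfl⟩ := pairExtend_injective he
    rfl
  · intro σ hmem
    have hσ : IsPfPerm h σ := by simpa using hmem
    obtain ⟨k, τ, rfl⟩ := exists_pairExtend σ hσ.apply_zero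
    exact ⟨⟨k, τ⟩, by simpa [isPfPerm_pairExtend h h'] using hσ, rfl⟩
  · rintro ⟨k, τ⟩ _
    rw [Fin.prod_univ_succ, sign_pairExtend]
    simp only [evenIdx_zero, oddIdx_zero, evenIdx_succ h h', oddIdx_succ h h', pairExtend_zero,
      pairExtend_one, pairExtend_succ_succ, Matrix.submatrix_apply, zsmul_eq_mul]
    push_cast
    ring

theorem pf_fin_zero {R : Type*} [CommRing R] (A : Matrix (Fin 0) (Fin 0) R) : pf A = 1 := by
  simp [pf]

/-- A functional on the exterior algebra satisfying the expansion rule for `β` sends a product of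
vectors to the pfaffian of their pairwise values under `β`. -/
theorem functional_ιMulti_eq_pf {R M : Type*} [CommRing R] [AddCommGroup M] [Module R M]
    (β : LinearMap.BilinForm R M) (φ : ExteriorAlgebra R M →ₗ[R] R) (h1 : φ 1 = 1)
    (hφ : ∀ v x, φ (ExteriorAlgebra.ι R v * x) =
      φ (CliffordAlgebra.contractLeft (Q := 0) (β v) x))
    (l : ℕ) (v : Fin (2 * l) → M) :
    φ (ExteriorAlgebra.ιMulti R (2 * l) v) = pf (Matrix.of fun a b => β (v a) (v b)) := by
  induction l with
  | zero =>
    refine Eq.trans ?_ (pf_fin_zero _).symm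
    rw [← h1]
    exact congrArg φ (ExteriorAlgebra.ιMulti_zero_apply v)
  | succ l ih =>
    refine Eq.trans ?_ (pf_succ (l := l) _).symm
    have e : φ (ExteriorAlgebra.ιMulti R (2 * l + 2) v) = _ :=
      congrArg φ (ExteriorAlgebra.ιMulti_succ_apply (n := 2 * l + 1) v)
    refine e.trans ?_
    rw [hφ]
    erw [contractLeft_ιMulti (β (v 0)) (n := 2 * l) (Matrix.vecTail v)]
    rw [map_sum]
    refine Finset.sum_congr rfl fun k _ => ?_
    rw [map_smul, ih, smul_eq_mul]
    rfl

theorem sum_fin_two_mul {A : Type*} [AddCommMonoid A] (r : ℕ) (f : Fin (2 * r) → A) :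
    ∑ x, f x = ∑ i, f (emb r i) + ∑ i, f (embBar r i) := by
  rw [← (finCongr (two_mul r)).symm.sum_comp, Fin.sum_univ_add]
  rfl

theorem Jmat_mul_emb {r : ℕ} {C : Type*} [CommRing C] (Y : Matrix (Fin (2 * r)) (Fin (2 * r)) C)
    (i : Fin r) (b : Fin (2 * r)) : (Jmat r C * Y) (emb r i) b = Y (embBar r i) b := by
  rw [Matrix.mul_apply, Finset.sum_eq_single (embBar r i)]
  · simp [Jmat, emb, embBar, add_comm]
  · intro c _ hc
    have h1 : (c : ℕ) ≠ i + r := fun h => hc (Fin.ext (by simp [embBar, h, add_comm]))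
    have h2 : (i : ℕ) ≠ c + r := by omega
    simp [Jmat, emb, h1, h2]
  · simp

theorem Jmat_mul_embBar {r : ℕ} {C : Type*} [CommRing C]
    (Y : Matrix (Fin (2 * r)) (Fin (2 * r)) C) (i : Fin r) (b : Fin (2 * r)) :
    (Jmat r C * Y) (embBar r i) b = -Y (emb r i) b := by
  rw [Matrix.mul_apply, Finset.sum_eq_single (emb r i)]
  · have h1 : (i : ℕ) ≠ r + i + r := by omega
    simp [Jmat, emb, embBar, h1, add_comm (i : ℕ) r]
  · intro c _ hc
    have h1 : (c : ℕ) ≠ r + i + r := by omega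
    have h2 : r + (i : ℕ) ≠ c + r := fun h => hc (Fin.ext (by simp only [emb]; omega))
    simp [Jmat, embBar, h1, h2]
  · simp

theorem eq_zero_of_eq_neg {C A : Type*} [CommRing C] [AddCommGroup A] [Module C A]
    (h2 : IsUnit (2 : C)) {x : A} (hx : x = -x) : x = 0 := by
  have h : (2 : C) • x = 0 := by
    rw [two_smul]
    nth_rewrite 1 [hx]
    exact neg_add_cancel x
  exact (h2.smul_eq_zero).mp h

namespace MemV

variable {r : ℕ} {C : Type*} [CommRing C] {Y : Matrix (Fin (2 * r)) (Fin (2 * r)) C}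

theorem apply_swap (hY : MemV r Y) (a b : Fin (2 * r)) : Y a b = -Y b a :=
  congrFun (congrFun hY.1 a) b

theorem sum_mul_emb (hY : MemV r Y) (a b : Fin (2 * r)) :
    ∑ i, Y (embBar r i) b * Y (emb r i) a = ∑ i, Y (emb r i) b * Y (embBar r i) a := by
  have h := congrFun (congrFun hY.2.2.1 a) b
  rw [Matrix.mul_assoc, Matrix.mul_apply, sum_fin_two_mul] at h
  simp only [Jmat_mul_emb, Jmat_mul_embBar, Matrix.transpose_apply, mul_neg,
    Finset.sum_neg_distrib, Matrix.zero_apply] at h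
  simp only [mul_comm (Y _ b)]
  exact eq_of_sub_eq_zero (by rw [sub_eq_add_neg]; exact h)

theorem sum_emb_embBar (hr : 0 < r) (h2 : IsUnit (2 : C)) (hY : MemV r Y) :
    ∑ i, Y (emb r i) (embBar r i) = 0 := by
  have : Nonempty (Fin (2 * r)) := ⟨⟨0, by omega⟩⟩
  have h : Matrix.trace (-(Jmat r C * Y)) = 0 := by
    rw [Matrix.trace_eq_neg_charpoly_coeff, hY.2.2.2, Polynomial.coeff_X_pow,
      if_neg (by rw [Fintype.card_fin]; omega), neg_zero]
  rw [Matrix.trace_neg, neg_eq_zero, Matrix.trace, sum_fin_two_mul] at h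
  simp only [Matrix.diag_apply, Jmat_mul_emb, Jmat_mul_embBar, Finset.sum_neg_distrib] at h
  refine eq_zero_of_eq_neg h2 ?_
  rw [← Finset.sum_neg_distrib, ← eq_of_sub_eq_zero ((sub_eq_add_neg _ _).trans h)]
  exact Finset.sum_congr rfl fun i _ => hY.apply_swap _ _

theorem toBilin'_self (h2 : IsUnit (2 : C)) (hY : MemV r Y) (v : Fin (2 * r) → C) :
    Matrix.toBilin' Y v v = 0 := by
  refine eq_zero_of_eq_neg h2 ?_
  rw [Matrix.toBilin'_apply]
  nth_rewrite 1 [Finset.sum_comm]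
  simp only [← Finset.sum_neg_distrib]
  refine Finset.sum_congr rfl fun a _ => Finset.sum_congr rfl fun b _ => ?_
  rw [hY.apply_swap a b]
  ring

end MemV

theorem toBilin'_single_eq_sum {n : ℕ} {C : Type*} [CommRing C] (Y : Matrix (Fin n) (Fin n) C)
    (a : Fin n) :
    Matrix.toBilin' Y (Pi.single a 1) = ∑ b, Y a b • LinearMap.proj (R := C) (φ := fun _ => C) b := by
  refine (Pi.basisFun C (Fin n)).ext fun b => ?_
  simp [Matrix.toBilin'_single, Pi.single_apply]

open CliffordAlgebra in
theorem MemV.sum_contractLeft_contractLeft {r : ℕ} {C : Type*} [CommRing C]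
    {Y : Matrix (Fin (2 * r)) (Fin (2 * r)) C} (h2 : IsUnit (2 : C)) (hY : MemV r Y)
    (x : CliffordAlgebra (0 : QuadraticForm C (Fin (2 * r) → C))) :
    ∑ i, contractLeft (Matrix.toBilin' Y (Pi.single (embBar r i) 1))
      (contractLeft (Matrix.toBilin' Y (Pi.single (emb r i) 1)) x) = 0 := by
  set D : Fin (2 * r) → CliffordAlgebra (0 : QuadraticForm C (Fin (2 * r) → C)) →ₗ[C] _ :=
    fun b => contractLeft (LinearMap.proj (R := C) (φ := fun _ => C) b) with hD
  have key : ∀ f g : Fin r → Fin (2 * r),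
      ∑ i, contractLeft (Matrix.toBilin' Y (Pi.single (f i) 1))
        (contractLeft (Matrix.toBilin' Y (Pi.single (g i) 1)) x) =
      ∑ b, ∑ c, (∑ i, Y (f i) b * Y (g i) c) • D b (D c x) := fun f g => by
    simp only [toBilin'_single_eq_sum, map_sum, map_smul, LinearMap.sum_apply,
      LinearMap.smul_apply, Finset.smul_sum, smul_smul, Finset.sum_smul, hD]
    conv_rhs => rw [Finset.sum_comm]
    rw [Finset.sum_comm]
    refine Finset.sum_congr rfl fun c _ => ?_
    rw [Finset.sum_comm]
    simp only [mul_comm]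
  refine eq_zero_of_eq_neg h2 ?_
  rw [key]
  nth_rewrite 1 [Finset.sum_comm]
  simp only [← Finset.sum_neg_distrib]
  refine Finset.sum_congr rfl fun a _ => Finset.sum_congr rfl fun b _ => ?_
  rw [hD, contractLeft_comm, smul_neg, hY.sum_mul_emb]
  simp only [mul_comm]

/-- In the exterior algebra, the product of the two basis vectors `i` and `ī`. -/
def basisPair (r : ℕ) (C : Type*) [CommRing C] (i : Fin r) :
    ExteriorAlgebra C (Fin (2 * r) → C) :=
  ExteriorAlgebra.ι C (Pi.single (emb r i) 1) * ExteriorAlgebra.ι C (Pi.single (embBar r i) 1)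

theorem MemV.functional_sum_basisPair_mul {r : ℕ} {C : Type*} [CommRing C]
    {Y : Matrix (Fin (2 * r)) (Fin (2 * r)) C} (hr : 0 < r) (h2 : IsUnit (2 : C)) (hY : MemV r Y)
    {φ : ExteriorAlgebra C (Fin (2 * r) → C) →ₗ[C] C}
    (hφ : ∀ v x, φ (ExteriorAlgebra.ι C v * x) =
      φ (CliffordAlgebra.contractLeft (Q := 0) (Matrix.toBilin' Y v) x))
    (x : ExteriorAlgebra C (Fin (2 * r) → C)) : φ ((∑ i, basisPair r C i) * x) = 0 := by
  have h : ∀ i, φ (basisPair r C i * x) = Y (emb r i) (embBar r i) * φ x -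
      φ (CliffordAlgebra.contractLeft (Q := 0) (Matrix.toBilin' Y (Pi.single (embBar r i) 1))
        (CliffordAlgebra.contractLeft (Q := 0)
          (Matrix.toBilin' Y (Pi.single (emb r i) 1)) x)) := fun i => by
    rw [basisPair, mul_assoc, hφ]
    erw [CliffordAlgebra.contractLeft_ι_mul]
    rw [map_sub, map_smul, Matrix.toBilin'_single]
    erw [hφ]
    rfl
  rw [Finset.sum_mul, map_sum, Finset.sum_congr rfl fun i _ => h i, Finset.sum_sub_distrib,
    ← Finset.sum_mul, hY.sum_emb_embBar hr h2, zero_mul, zero_sub, neg_eq_zero, ← map_sum]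
  exact (congrArg φ (hY.sum_contractLeft_contractLeft h2 x)).trans (map_zero φ)

/-- The product of the elements `z i` for `i ∈ s`, in increasing order. -/
def sortProd {r : ℕ} {A : Type*} [Monoid A] (z : Fin r → A) (s : Finset (Fin r)) : A :=
  ((s.sort (· ≤ ·)).map z).prod

section sortProd

variable {r : ℕ} {A : Type*}

theorem prod_map_eq_sortProd [Monoid A] {z : Fin r → A} (hz : ∀ i j, Commute (z i) (z j))
    {L : List (Fin r)} {s : Finset (Fin r)} (h : L.Perm (s.sort (· ≤ ·))) :
    (L.map z).prod = sortProd z s := by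
  refine (h.map z).prod_eq' ?_
  rw [List.pairwise_map]
  exact List.pairwise_of_forall fun i j => hz i j

theorem sortProd_insert [Monoid A] {z : Fin r → A} (hz : ∀ i j, Commute (z i) (z j))
    {i : Fin r} {s : Finset (Fin r)} (hi : i ∉ s) :
    sortProd z (insert i s) = z i * sortProd z s := by
  rw [← prod_map_eq_sortProd hz (L := i :: s.sort (· ≤ ·)), List.map_cons, List.prod_cons, sortProd]
  rw [List.perm_ext_iff_of_nodup (List.nodup_cons.2 ⟨by simpa using hi, s.sort_nodup _⟩)
    (Finset.sort_nodup _ _)]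
  simp

theorem sortProd_union [Monoid A] {z : Fin r → A} (hz : ∀ i j, Commute (z i) (z j))
    {s t : Finset (Fin r)} (h : Disjoint s t) :
    sortProd z (s ∪ t) = sortProd z s * sortProd z t := by
  rw [← prod_map_eq_sortProd hz (L := s.sort (· ≤ ·) ++ t.sort (· ≤ ·)), List.map_append,
    List.prod_append, sortProd, sortProd]
  rw [List.perm_ext_iff_of_nodup (List.nodup_append'.2 ⟨s.sort_nodup _, t.sort_nodup _, ?_⟩)
    (Finset.sort_nodup _ _)]
  · simp
  · intro a ha hb
    exact Finset.disjoint_left.1 h (by simpa using ha) (by simpa using hb)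

theorem mul_sortProd_eq_zero [MonoidWithZero A] {z : Fin r → A} (hz : ∀ i j, Commute (z i) (z j))
    (hz0 : ∀ i, z i * z i = 0) {i : Fin r} {s : Finset (Fin r)} (hi : i ∈ s) :
    z i * sortProd z s = 0 := by
  rw [← Finset.insert_erase hi, sortProd_insert hz (Finset.notMem_erase i s), ← mul_assoc, hz0,
    zero_mul]

/-- For commuting elements of square zero, the product of the first and the `t`-th elementary
symmetric sums is `t + 1` times the next elementary symmetric sum. -/
theorem sum_mul_sum_sortProd [Semiring A] {z : Fin r → A} (hz : ∀ i j, Commute (z i) (z j))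
    (hz0 : ∀ i, z i * z i = 0) (t : ℕ) :
    (∑ i, z i) * ∑ s ∈ Finset.univ.powersetCard t, sortProd z s =
      (t + 1) • ∑ s ∈ Finset.univ.powersetCard (t + 1), sortProd z s := by
  have hL : (∑ i, z i) * ∑ s ∈ Finset.univ.powersetCard t, sortProd z s =
      ∑ s ∈ Finset.univ.powersetCard t, ∑ i ∈ sᶜ, sortProd z (insert i s) := by
    rw [Finset.mul_sum]
    refine Finset.sum_congr rfl fun s _ => ?_
    rw [Finset.sum_mul, ← Finset.sum_subset (Finset.subset_univ sᶜ)]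
    · exact Finset.sum_congr rfl fun i hi => (sortProd_insert hz (Finset.mem_compl.1 hi)).symm
    · intro i _ hi
      exact mul_sortProd_eq_zero hz hz0 (by simpa using hi)
  have hR : (t + 1) • ∑ s ∈ Finset.univ.powersetCard (t + 1), sortProd z s =
      ∑ s ∈ Finset.univ.powersetCard (t + 1), ∑ _i ∈ s, sortProd z s := by
    rw [Finset.smul_sum]
    refine Finset.sum_congr rfl fun s hs => ?_
    rw [Finset.sum_const, (Finset.mem_powersetCard.1 hs).2]
  rw [hL, hR, Finset.sum_sigma', Finset.sum_sigma']
  refine Finset.sum_bij' (fun p _ => ⟨insert p.2 p.1, p.2⟩) (fun p _ => ⟨p.1.erase p.2, p.2⟩)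
    ?_ ?_ ?_ ?_ ?_
  · rintro ⟨s, i⟩ h
    simp only [Finset.mem_sigma, Finset.mem_powersetCard_univ, Finset.mem_compl] at h ⊢
    exact ⟨by rw [Finset.card_insert_of_notMem h.2, h.1], Finset.mem_insert_self _ _⟩
  · rintro ⟨s, i⟩ h
    simp only [Finset.mem_sigma, Finset.mem_powersetCard_univ, Finset.mem_compl] at h ⊢
    exact ⟨by rw [Finset.card_erase_of_mem h.2, h.1, Nat.add_sub_cancel], Finset.notMem_erase _ _⟩
  · rintro ⟨s, i⟩ h
    simp only [Finset.mem_sigma, Finset.mem_compl] at h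
    simp [Finset.erase_insert h.2]
  · rintro ⟨s, i⟩ h
    simp only [Finset.mem_sigma] at h
    simp [Finset.insert_erase h.2]
  · intro _ _
    rfl

end sortProd

theorem ι_mul_ι_eq_neg {R M : Type*} [CommRing R] [AddCommGroup M] [Module R M] (v w : M) :
    ExteriorAlgebra.ι R v * ExteriorAlgebra.ι R w =
      -(ExteriorAlgebra.ι R w * ExteriorAlgebra.ι R v) :=
  eq_neg_of_add_eq_zero_left (ExteriorAlgebra.ι_add_mul_swap v w)

theorem ι_mul_prod_map_eq_zero {R M α : Type*} [CommRing R] [AddCommGroup M] [Module R M]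
    (e : α → M) {a : α} {L : List α} (h : a ∈ L) :
    ExteriorAlgebra.ι R (e a) * (L.map fun b => ExteriorAlgebra.ι R (e b)).prod = 0 := by
  induction L with
  | nil => simp at h
  | cons b L ih =>
    rw [List.map_cons, List.prod_cons, ← mul_assoc]
    rcases List.mem_cons.1 h with rfl | h
    · rw [ExteriorAlgebra.ι_sq_zero, zero_mul]
    · rw [ι_mul_ι_eq_neg, neg_mul, mul_assoc, ih h, mul_zero, neg_zero]

theorem commute_ι_mul_ι {R M : Type*} [CommRing R] [AddCommGroup M] [Module R M] (a b c d : M) :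
    Commute (ExteriorAlgebra.ι R a * ExteriorAlgebra.ι R b)
      (ExteriorAlgebra.ι R c * ExteriorAlgebra.ι R d) := by
  have h : ∀ x, Commute (ExteriorAlgebra.ι R a * ExteriorAlgebra.ι R b) (ExteriorAlgebra.ι R x) :=
    fun x => by
      rw [Commute, SemiconjBy, mul_assoc, ι_mul_ι_eq_neg b x, mul_neg, ← mul_assoc,
        ι_mul_ι_eq_neg a x, neg_mul, neg_neg, mul_assoc]
  exact (h c).mul_right (h d)

theorem basisPair_commute (r : ℕ) (C : Type*) [CommRing C] (i j : Fin r) :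
    Commute (basisPair r C i) (basisPair r C j) :=
  commute_ι_mul_ι _ _ _ _

theorem basisPair_mul_self (r : ℕ) (C : Type*) [CommRing C] (i : Fin r) :
    basisPair r C i * basisPair r C i = 0 := by
  rw [basisPair, ← mul_assoc, mul_assoc (ExteriorAlgebra.ι C _), ι_mul_ι_eq_neg (Pi.single _ _),
    mul_neg, ← mul_assoc, ExteriorAlgebra.ι_sq_zero, zero_mul, neg_zero, zero_mul]

/-- The product in the exterior algebra of the basis vectors with indices in a list. -/
def basisProd {n : ℕ} (C : Type*) [CommRing C] (L : List (Fin n)) :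
    ExteriorAlgebra C (Fin n → C) :=
  (L.map fun a => ExteriorAlgebra.ι C (Pi.single a (1 : C) : Fin n → C)).prod

theorem functional_basisProd_eq_listPf {n : ℕ} {C : Type*} [CommRing C]
    {Y : Matrix (Fin n) (Fin n) C} {φ : ExteriorAlgebra C (Fin n → C) →ₗ[C] C} (h1 : φ 1 = 1)
    (hφ : ∀ v x, φ (ExteriorAlgebra.ι C v * x) =
      φ (CliffordAlgebra.contractLeft (Q := 0) (Matrix.toBilin' Y v) x))
    {L : List (Fin n)} {l : ℕ} (hL : L.length = 2 * l) : φ (basisProd C L) = listPf Y L := by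
  have key : ∀ (k : ℕ) (f : Fin k → Fin n), k = 2 * l →
      φ (ExteriorAlgebra.ιMulti C k fun a => Pi.single (f a) (1 : C)) =
        pf (Matrix.of fun a b => Y (f a) (f b)) := by
    rintro k f rfl
    rw [functional_ιMulti_eq_pf _ φ h1 hφ]
    simp only [Matrix.toBilin'_single]
  rw [listPf, ← key _ L.get hL, ExteriorAlgebra.ιMulti_apply, basisProd]
  congr 2
  conv_lhs => rw [← List.ofFn_get L, List.map_ofFn]
  rfl

theorem basisProd_pqList {r : ℕ} (C : Type*) [CommRing C] (P Q : Finset (Fin r)) :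
    basisProd C (pqList r P Q) = sortProd (basisPair r C) (P ∩ Q) *
      basisProd C (((P \ Q).sort (· ≤ ·)).map (emb r) ++ ((Q \ P).sort (· ≤ ·)).map (embBar r)) := by
  have h : ∀ L : List (Fin r), basisProd C (L.flatMap fun γ => [emb r γ, embBar r γ]) =
      (L.map (basisPair r C)).prod := fun L => by
    induction L with
    | nil => simp [basisProd]
    | cons a L ih =>
      rw [List.map_cons, List.prod_cons, ← ih]
      simp [basisProd, basisPair, mul_assoc]
  rw [sortProd, ← h, pqList, List.append_assoc, basisProd, List.map_append, List.prod_append]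
  rfl

theorem basisProd_pqList_union {r : ℕ} (C : Type*) [CommRing C] {P Q s : Finset (Fin r)}
    (hs : Disjoint s (P ∪ Q)) :
    basisProd C (pqList r (P ∪ s) (Q ∪ s)) =
      sortProd (basisPair r C) s * basisProd C (pqList r P Q) := by
  rw [Finset.disjoint_union_right] at hs
  have h1 : (P ∪ s) ∩ (Q ∪ s) = s ∪ P ∩ Q := by
    rw [← Finset.inter_union_distrib_right, Finset.union_comm]
  have h2 : ∀ {P Q : Finset (Fin r)}, Disjoint s P → (P ∪ s) \ (Q ∪ s) = P \ Q := fun {P Q} h => by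
    ext a
    have : a ∈ P → a ∉ s := fun ha => Finset.disjoint_right.1 h ha
    simp only [Finset.mem_sdiff, Finset.mem_union]
    tauto
  rw [basisProd_pqList, basisProd_pqList, h1, h2 hs.1, h2 hs.2,
    sortProd_union (basisPair_commute r C) (hs.1.mono_right Finset.inter_subset_left), mul_assoc]

theorem mem_pqList_of_mem_union {r : ℕ} {P Q : Finset (Fin r)} {i : Fin r} (hi : i ∈ P ∪ Q) :
    emb r i ∈ pqList r P Q ∨ embBar r i ∈ pqList r P Q := by
  by_cases hP : i ∈ P
  · refine Or.inl ?_
    by_cases hQ : i ∈ Q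
    · refine List.mem_append_left _ (List.mem_append_left _ ?_)
      exact List.mem_flatMap.2 ⟨i, by simp [hP, hQ], by simp⟩
    · refine List.mem_append_left _ (List.mem_append_right _ ?_)
      exact List.mem_map.2 ⟨i, by simp [hP, hQ], rfl⟩
  · have hQ : i ∈ Q := (Finset.mem_union.1 hi).resolve_left hP
    refine Or.inr (List.mem_append_right _ ?_)
    exact List.mem_map.2 ⟨i, by simp [hP, hQ], rfl⟩

theorem sortProd_mul_basisProd_eq_zero {r : ℕ} (C : Type*) [CommRing C] {P Q s : Finset (Fin r)}
    (hs : ¬Disjoint s (P ∪ Q)) :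
    sortProd (basisPair r C) s * basisProd C (pqList r P Q) = 0 := by
  obtain ⟨i, his, hi⟩ := Finset.not_disjoint_iff.1 hs
  have hc : Commute (basisPair r C i) (sortProd (basisPair r C) (s.erase i)) :=
    Commute.list_prod_right _ _ fun x hx => by
      obtain ⟨j, -, rfl⟩ := List.mem_map.1 hx
      exact basisPair_commute r C i j
  rw [← Finset.insert_erase his,
    sortProd_insert (basisPair_commute r C) (Finset.notMem_erase i s), hc.eq, mul_assoc]
  suffices basisPair r C i * basisProd C (pqList r P Q) = 0 by rw [this, mul_zero]
  rw [basisPair, basisProd]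
  rcases mem_pqList_of_mem_union hi with h | h
  · rw [ι_mul_ι_eq_neg, neg_mul, mul_assoc,
      ι_mul_prod_map_eq_zero (fun a => (Pi.single a (1 : C) : Fin (2 * r) → C)) h, mul_zero,
      neg_zero]
  · rw [mul_assoc, ι_mul_prod_map_eq_zero (fun a => (Pi.single a (1 : C) : Fin (2 * r) → C)) h,
      mul_zero]

theorem length_pqList {r : ℕ} (P Q : Finset (Fin r)) :
    (pqList r P Q).length = P.card + Q.card := by
  have h1 := Finset.card_sdiff_add_card_inter P Q
  have h2 := Finset.card_sdiff_add_card_inter Q P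
  rw [Finset.inter_comm] at h2
  have h3 : ∀ L : List (Fin r), (L.flatMap fun γ => [emb r γ, embBar r γ]).length = 2 * L.length :=
    fun L => by simp [List.length_flatMap, mul_comm]
  simp only [pqList, List.length_append, h3, List.length_map, Finset.length_sort]
  omega

theorem isUnit_natCast_of_le {F C : Type*} [Field F] [CommRing C] [Algebra F C] {r k : ℕ}
    (hchar : ringChar F = 0 ∨ r < ringChar F) (h0 : 0 < k) (hk : k ≤ r) : IsUnit (k : C) := by
  have h : (k : F) ≠ 0 := fun h => by
    have hdvd := (ringChar.spec F k).1 h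
    rcases hchar with hc | hc
    · rw [hc, zero_dvd_iff] at hdvd
      omega
    · have := Nat.le_of_dvd h0 hdvd
      omega
  simpa using (IsUnit.mk0 _ h).map (algebraMap F C)

/-- For `Y ∈ V(C)` over an `F`-algebra `C` with `char F = 0` or
`char F > r`, `k = 2m` with `1 ≤ t ≤ m ≤ r`, and `P', Q' ⊆ {1,…,r}` with
`|P'| + |Q'| = k − 2t`, we have `∑_{Γₜ} [P' ∪ Γₜ, Q̄' ∪ Γ̄ₜ] = 0`, the sum over all size-`t`
subsets `Γₜ ⊆ {1,…,r} ∖ (P' ∪ Q')`. -/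
theorem pfaffian_sum_vanishes_of_char (r : ℕ) (hn : 4 ≤ 2 * r) (F : Type*) [Field F]
    (hchar : ringChar F = 0 ∨ r < ringChar F)
    (C : Type*) [CommRing C] [Algebra F C]
    (Y : Matrix (Fin (2 * r)) (Fin (2 * r)) C) (hY : MemV r Y)
    (m t : ℕ) (ht1 : 1 ≤ t) (htm : t ≤ m) (hmr : m ≤ r)
    (P' Q' : Finset (Fin r)) (hcard : P'.card + Q'.card = 2 * m - 2 * t) :
    ∑ Γt ∈ (Finset.univ \ (P' ∪ Q')).powerset.filter (fun s => s.card = t),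
      pfPQ r Y (P' ∪ Γt) (Q' ∪ Γt) = 0 := by
  have h2 : IsUnit (2 : C) := by
    simpa using isUnit_natCast_of_le (C := C) hchar (k := 2) (by omega) (by omega)
  have ht : IsUnit (t : C) := isUnit_natCast_of_le hchar ht1 (htm.trans hmr)
  obtain ⟨φ, hφ1, hφ⟩ :=
    exists_functional_contractLeft (Matrix.toBilin' Y) (hY.toBilin'_self h2)
  set x := basisProd C (pqList r P' Q')
  have hdisj : ∀ {s : Finset (Fin r)}, s ⊆ Finset.univ \ (P' ∪ Q') ↔ Disjoint s (P' ∪ Q') := by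
    intro s
    rw [← Finset.compl_eq_univ_sdiff, Finset.subset_compl_iff_disjoint_right]
  have hpf : ∑ Γt ∈ (Finset.univ \ (P' ∪ Q')).powerset.filter (fun s => s.card = t),
      pfPQ r Y (P' ∪ Γt) (Q' ∪ Γt) =
      ∑ s ∈ Finset.univ.powersetCard t, φ (sortProd (basisPair r C) s * x) := by
    refine Finset.sum_subset_zero_on_sdiff ?_ ?_ ?_
    · intro s hs
      simpa using (Finset.mem_filter.1 hs).2
    · intro s hs
      rw [Finset.mem_sdiff, Finset.mem_filter, Finset.mem_powerset, hdisj,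
        Finset.mem_powersetCard_univ] at hs
      rw [sortProd_mul_basisProd_eq_zero C fun h => hs.2 ⟨h, hs.1⟩, map_zero]
    · intro s hs
      rw [Finset.mem_filter, Finset.mem_powerset, hdisj] at hs
      have hs' := Finset.disjoint_union_right.1 hs.1
      rw [pfPQ, ← functional_basisProd_eq_listPf hφ1 hφ (l := m), basisProd_pqList_union C hs.1]
      rw [length_pqList, Finset.card_union_of_disjoint hs'.1.symm,
        Finset.card_union_of_disjoint hs'.2.symm]
      omega
  obtain ⟨t, rfl⟩ : ∃ u, t = u + 1 := ⟨t - 1, by omega⟩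
  rw [hpf, ← map_sum, ← Finset.sum_mul, ← ht.mul_right_eq_zero]
  have h := hY.functional_sum_basisPair_mul (by omega) h2 hφ
    ((∑ s ∈ Finset.univ.powersetCard t, sortProd (basisPair r C) s) * x)
  rwa [← mul_assoc, sum_mul_sum_sortProd (basisPair_commute r C) (basisPair_mul_self r C),
    smul_mul_assoc, map_nsmul, nsmul_eq_mul] at h

end PR
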